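/- Einstein gyrations are isometries of the ball fixing the origin: for all u, v, a, b in the c-ball V_c, ⟨gyr[u,v]a, gyr[u,v]b⟩ = ⟨a, b⟩, and consequently ‖gyr[u,v]w‖ = ‖w‖ for all w ∈ V_c. -/

import Mathlib

open scoped RealInnerProductSpace

noncomputable def gamma {V : Type*} [NormedAddCommGroup V] [InnerProductSpace ℝ V]
    (c : ℝ) (u : V) : ℝ :=
  1 / Real.sqrt (1 - ‖u‖ ^ 2 / c ^ 2)

noncomputable def eAdd {V : Type*} [NormedAddCommGroup V] [InnerProductSpace ℝ V]
    (c : ℝ) (u v : V) : V :=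
  (1 / (1 + ⟪u, v⟫ / c ^ 2)) •
    (u + (1 / gamma c u) • v +
      ((1 / c ^ 2) * (gamma c u / (1 + gamma c u)) * ⟪u, v⟫) • u)

noncomputable def eGyr {V : Type*} [NormedAddCommGroup V] [InnerProductSpace ℝ V]
    (c : ℝ) (u v w : V) : V :=
  eAdd c (-(eAdd c u v)) (eAdd c u (eAdd c v w))

noncomputable def eCoadd {V : Type*} [NormedAddCommGroup V] [InnerProductSpace ℝ V]
    (c : ℝ) (u v : V) : V :=
  eAdd c u (eGyr c u (-v) v)

noncomputable def mAdd {V : Type*} [NormedAddCommGroup V] [InnerProductSpace ℝ V]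
    (s : ℝ) (u v : V) : V :=
  (1 / (1 + (2 / s ^ 2) * ⟪u, v⟫ + (1 / s ^ 4) * ‖u‖ ^ 2 * ‖v‖ ^ 2)) •
    ((1 + (2 / s ^ 2) * ⟪u, v⟫ + (1 / s ^ 2) * ‖v‖ ^ 2) • u +
      (1 - (1 / s ^ 2) * ‖u‖ ^ 2) • v)

noncomputable def mGyr {V : Type*} [NormedAddCommGroup V] [InnerProductSpace ℝ V]
    (s : ℝ) (u v w : V) : V :=
  mAdd s (-(mAdd s u v)) (mAdd s u (mAdd s v w))

noncomputable def mCoadd {V : Type*} [NormedAddCommGroup V] [InnerProductSpace ℝ V]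
    (s : ℝ) (u v : V) : V :=
  mAdd s u (mGyr s u (-v) v)

noncomputable def artanh (x : ℝ) : ℝ :=
  (1 / 2) * Real.log ((1 + x) / (1 - x))

open Classical in
noncomputable def sMul {V : Type*} [NormedAddCommGroup V] [InnerProductSpace ℝ V]
    (c : ℝ) (r : ℝ) (v : V) : V :=
  if v = 0 then 0 else (c * Real.tanh (r * artanh (‖v‖ / c)) / ‖v‖) • v

variable {V : Type*} [NormedAddCommGroup V] [InnerProductSpace ℝ V]

theorem one_sub_norm_sq_div_sq_pos {c : ℝ} {u : V} (hu : ‖u‖ < c) :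
    0 < 1 - ‖u‖ ^ 2 / c ^ 2 := by
  have hc : 0 < c := (norm_nonneg u).trans_lt hu
  have h : ‖u‖ ^ 2 < c ^ 2 := by gcongr
  rw [sub_pos, div_lt_one (by positivity)]
  exact h

theorem gamma_pos {c : ℝ} {u : V} (hu : ‖u‖ < c) : 0 < gamma c u :=
  one_div_pos.2 (Real.sqrt_pos.2 (one_sub_norm_sq_div_sq_pos hu))

theorem gamma_sq_mul {c : ℝ} {u : V} (hu : ‖u‖ < c) :
    gamma c u ^ 2 * (1 - ‖u‖ ^ 2 / c ^ 2) = 1 := by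
  have h := one_sub_norm_sq_div_sq_pos hu
  rw [gamma, div_pow, Real.sq_sqrt h.le]
  field_simp

theorem one_add_inner_div_sq_pos {c : ℝ} {u v : V} (hu : ‖u‖ < c) (hv : ‖v‖ < c) :
    0 < 1 + ⟪u, v⟫ / c ^ 2 := by
  have hc : 0 < c := (norm_nonneg u).trans_lt hu
  have h₁ : -(‖u‖ * ‖v‖) ≤ ⟪u, v⟫ := (abs_le.1 (abs_real_inner_le_norm u v)).1
  have h₂ : ‖u‖ * ‖v‖ < c * c :=
    mul_lt_mul'' hu hv (norm_nonneg u) (norm_nonneg v)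
  have h₃ : -1 < ⟪u, v⟫ / c ^ 2 := by
    rw [lt_div_iff₀ (by positivity)]
    linarith
  linarith

theorem one_sub_inner_eAdd {c : ℝ} {u a b : V} (hu : ‖u‖ < c) (ha : ‖a‖ < c) (hb : ‖b‖ < c) :
    1 - ⟪eAdd c u a, eAdd c u b⟫ / c ^ 2 =
      (1 - ⟪a, b⟫ / c ^ 2) /
        (gamma c u ^ 2 * (1 + ⟪u, a⟫ / c ^ 2) * (1 + ⟪u, b⟫ / c ^ 2)) := by
  have hc : 0 < c := (norm_nonneg u).trans_lt hu
  have hg := gamma_pos hu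
  have hA := one_add_inner_div_sq_pos hu ha
  have hB := one_add_inner_div_sq_pos hu hb
  have hU : ‖u‖ ^ 2 = c ^ 2 * (1 - 1 / gamma c u ^ 2) := by
    have := gamma_sq_mul hu
    field_simp at this ⊢
    linarith
  unfold eAdd
  simp only [inner_add_left, inner_add_right, real_inner_smul_left, real_inner_smul_right,
    real_inner_self_eq_norm_sq, real_inner_comm u a, hU]
  generalize gamma c u = g at *
  generalize ⟪u, b⟫ = B at *
  generalize ⟪u, a⟫ = A at *
  have hA' : c ^ 2 + A ≠ 0 := by
    have : c ^ 2 + A = c ^ 2 * (1 + A / c ^ 2) := by field_simp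
    rw [this]; positivity
  have hB' : c ^ 2 + B ≠ 0 := by
    have : c ^ 2 + B = c ^ 2 * (1 + B / c ^ 2) := by field_simp
    rw [this]; positivity
  field_simp
  ring

theorem norm_eAdd_lt {c : ℝ} {u v : V} (hu : ‖u‖ < c) (hv : ‖v‖ < c) : ‖eAdd c u v‖ < c := by
  have hc : 0 < c := (norm_nonneg u).trans_lt hu
  have h := one_sub_inner_eAdd hu hv hv
  simp only [real_inner_self_eq_norm_sq] at h
  have hpos : 0 < 1 - ‖eAdd c u v‖ ^ 2 / c ^ 2 := by
    rw [h]
    have := one_sub_norm_sq_div_sq_pos hv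
    have := gamma_pos hu
    have := one_add_inner_div_sq_pos hu hv
    positivity
  rw [sub_pos, div_lt_one (by positivity)] at hpos
  exact lt_of_pow_lt_pow_left₀ 2 hc.le hpos

theorem gamma_eAdd {c : ℝ} {u v : V} (hu : ‖u‖ < c) (hv : ‖v‖ < c) :
    gamma c (eAdd c u v) = gamma c u * gamma c v * (1 + ⟪u, v⟫ / c ^ 2) := by
  have hgu := gamma_pos hu
  have hI := one_add_inner_div_sq_pos hu hv
  have hgv := gamma_pos hv
  have h := one_sub_inner_eAdd hu hv hv
  simp only [real_inner_self_eq_norm_sq] at h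
  have hw := gamma_sq_mul (norm_eAdd_lt hu hv)
  have hv' := gamma_sq_mul hv
  rw [h, mul_div_assoc', div_eq_one_iff_eq (by positivity)] at hw
  refine (sq_eq_sq₀ (gamma_pos (norm_eAdd_lt hu hv)).le (by positivity)).1 ?_
  linear_combination gamma c v ^ 2 * hw - gamma c (eAdd c u v) ^ 2 * hv'

/-- The Minkowski product of the four-velocities of `a` and `b`; by `lorentz_eAdd` it is
invariant under left Einstein translations. -/
noncomputable def lorentz (c : ℝ) (a b : V) : ℝ :=
  gamma c a * gamma c b * (1 - ⟪a, b⟫ / c ^ 2)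

theorem lorentz_eAdd {c : ℝ} {u a b : V} (hu : ‖u‖ < c) (ha : ‖a‖ < c) (hb : ‖b‖ < c) :
    lorentz c (eAdd c u a) (eAdd c u b) = lorentz c a b := by
  have hgu := gamma_pos hu
  have hA := one_add_inner_div_sq_pos hu ha
  have hB := one_add_inner_div_sq_pos hu hb
  rw [lorentz, gamma_eAdd hu ha, gamma_eAdd hu hb, one_sub_inner_eAdd hu ha hb, lorentz]
  generalize 1 + ⟪u, a⟫ / c ^ 2 = A at *
  generalize 1 + ⟪u, b⟫ / c ^ 2 = B at *
  generalize 1 - ⟪a, b⟫ / c ^ 2 = D at *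
  field_simp

theorem lorentz_eGyr {c : ℝ} {u v a b : V} (hu : ‖u‖ < c) (hv : ‖v‖ < c)
    (ha : ‖a‖ < c) (hb : ‖b‖ < c) :
    lorentz c (eGyr c u v a) (eGyr c u v b) = lorentz c a b := by
  have huv : ‖-(eAdd c u v)‖ < c := by simpa using norm_eAdd_lt hu hv
  have hva := norm_eAdd_lt hv ha
  have hvb := norm_eAdd_lt hv hb
  rw [eGyr, eGyr, lorentz_eAdd huv (norm_eAdd_lt hu hva) (norm_eAdd_lt hu hvb),
    lorentz_eAdd hu hva hvb, lorentz_eAdd hv ha hb]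

theorem eAdd_zero (c : ℝ) (v : V) : eAdd c v 0 = v := by
  simp [eAdd]

theorem eAdd_neg_self {c : ℝ} {u : V} (hu : ‖u‖ < c) : eAdd c (-u) u = 0 := by
  have hc : 0 < c := (norm_nonneg u).trans_lt hu
  have hg := gamma_pos hu
  have hU : ‖u‖ ^ 2 = c ^ 2 * (1 - 1 / gamma c u ^ 2) := by
    have := gamma_sq_mul hu
    field_simp at this ⊢
    linarith
  have hneg : gamma c (-u) = gamma c u := by simp [gamma]
  unfold eAdd
  rw [hneg, inner_neg_left, real_inner_self_eq_norm_sq, hU]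
  refine smul_eq_zero_of_right _ ?_
  match_scalars
  field_simp
  ring

theorem eGyr_zero {c : ℝ} {u v : V} (hu : ‖u‖ < c) (hv : ‖v‖ < c) : eGyr c u v 0 = 0 := by
  rw [eGyr, eAdd_zero, eAdd_neg_self (norm_eAdd_lt hu hv)]

theorem lorentz_zero_left (c : ℝ) (a : V) : lorentz c 0 a = gamma c a := by
  simp [lorentz, gamma]

theorem gamma_eGyr {c : ℝ} {u v w : V} (hu : ‖u‖ < c) (hv : ‖v‖ < c) (hw : ‖w‖ < c) :
    gamma c (eGyr c u v w) = gamma c w := by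
  have h0 : ‖(0 : V)‖ < c := by simpa using (norm_nonneg u).trans_lt hu
  rw [← lorentz_zero_left, ← lorentz_zero_left, ← lorentz_eGyr hu hv h0 hw, eGyr_zero hu hv]

theorem inner_eGyr {c : ℝ} {u v a b : V} (hu : ‖u‖ < c) (hv : ‖v‖ < c)
    (ha : ‖a‖ < c) (hb : ‖b‖ < c) : ⟪eGyr c u v a, eGyr c u v b⟫ = ⟪a, b⟫ := by
  have hc : 0 < c := (norm_nonneg u).trans_lt hu
  have h := lorentz_eGyr hu hv ha hb
  rw [lorentz, lorentz, gamma_eGyr hu hv ha, gamma_eGyr hu hv hb] at h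
  have h' := mul_left_cancel₀ (mul_pos (gamma_pos ha) (gamma_pos hb)).ne' h
  exact (div_left_inj' (by positivity)).1 (sub_right_injective h')

theorem einstein_gyr_isometry (c : ℝ) (hc : 0 < c) (u v : V)
    (hu : ‖u‖ < c) (hv : ‖v‖ < c) :
    (∀ a b : V, ‖a‖ < c → ‖b‖ < c →
      ⟪eGyr c u v a, eGyr c u v b⟫ = ⟪a, b⟫) ∧
    (∀ w : V, ‖w‖ < c → ‖eGyr c u v w‖ = ‖w‖) := by
  refine ⟨fun a b ha hb => inner_eGyr hu hv ha hb, fun w hw => ?_⟩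
  rw [norm_eq_sqrt_real_inner, inner_eGyr hu hv hw hw, ← norm_eq_sqrt_real_inner]
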